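/- In the multi-commodity single-arc comparison setting, suppose additionally that there are nonnegative, bounded, locally integrable functions f⁺, f⁻, h⁺, h⁻ on ℝ vanishing on (−∞,0) with F(θ) = ∫₀^θ f⁺, H(θ) = ∫₀^θ h⁺, such that (f⁺, f⁻) and (h⁺, h⁻) are Vickrey queue flows for the arc; write F⁻(θ) := ∫₀^θ f⁻ and H⁻(θ) := ∫₀^θ h⁻. Suppose that for every j' ∈ J and every ψ ∈ βℕ with ψ ≤ β⌊m_{j'}/β⌋ such that ℓ_{j'}(ψ) ≤ θ + 3δ or k_{j'}(ψ) ≤ ζ + 3δ, one has |ℓ_{j'}(ψ) − k_{j'}(ψ)| ≤ δ. Then the total cumulative outflows at the respective queue-entrance times of particle φ are close: |F⁻(θ + τ) − H⁻(ζ + τ)| ≤ 7κδ. (Claim 2 in the proof of Lemma 5.3.) -/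

import Mathlib

open MeasureTheory

/-- The cumulative function `F(θ) = ∫₀^θ f(ξ) dξ` of a rate function `f`. -/
noncomputable def cumul (f : ℝ → ℝ) (θ : ℝ) : ℝ := ∫ ξ in (0:ℝ)..θ, f ξ

/-- A Vickrey queue flow for an arc with transit time `τ` and capacity `ν`: a pair
`(fi, fo)` of nonnegative, bounded, locally integrable inflow/outflow rates vanishing on
`(−∞, 0)`, whose queue size `z(θ) = F⁺(θ − τ) − F⁻(θ)` is nonnegative, and such that for
almost every `θ`: `fo θ = ν` if `z θ > 0`, and `fo θ = min (fi (θ − τ)) ν` if `z θ = 0`. -/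
def IsVickreyFlow (τ ν : ℝ) (fi fo : ℝ → ℝ) : Prop :=
  (∀ θ, 0 ≤ fi θ) ∧ (∀ θ, 0 ≤ fo θ) ∧
  (∃ M : ℝ, ∀ θ, fi θ ≤ M ∧ fo θ ≤ M) ∧
  LocallyIntegrable fi ∧ LocallyIntegrable fo ∧
  (∀ θ < (0:ℝ), fi θ = 0) ∧ (∀ θ < (0:ℝ), fo θ = 0) ∧
  (∀ θ : ℝ, 0 ≤ cumul fi (θ - τ) - cumul fo θ) ∧
  (∀ᵐ θ : ℝ ∂volume,
    (0 < cumul fi (θ - τ) - cumul fo θ → fo θ = ν) ∧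
    (cumul fi (θ - τ) - cumul fo θ = 0 → fo θ = min (fi (θ - τ)) ν))

lemma intervalIntegrable_of_locallyIntegrable {f : ℝ → ℝ} (hf : LocallyIntegrable f) (a b : ℝ) :
    IntervalIntegrable f volume a b :=
  (hf.integrableOn_isCompact isCompact_uIcc).intervalIntegrable

lemma cumul_sub_cumul {f : ℝ → ℝ} (hf : LocallyIntegrable f) (a b : ℝ) :
    cumul f b - cumul f a = ∫ x in a..b, f x :=
  intervalIntegral.integral_interval_sub_left (intervalIntegrable_of_locallyIntegrable hf _ _)
    (intervalIntegrable_of_locallyIntegrable hf _ _)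

lemma continuous_cumul {f : ℝ → ℝ} (hf : LocallyIntegrable f) : Continuous (cumul f) :=
  intervalIntegral.continuous_primitive (intervalIntegrable_of_locallyIntegrable hf) 0

lemma IsVickreyFlow.cumul_outflow_le {τ ν : ℝ} {fi fo : ℝ → ℝ} (h : IsVickreyFlow τ ν fi fo)
    {a b : ℝ} (hab : a ≤ b) : cumul fo b ≤ cumul fo a + ν * (b - a) := by
  obtain ⟨-, -, -, -, hfo, -, -, hz, hae⟩ := h
  have hle : ∀ᵐ x : ℝ, fo x ≤ ν := by
    filter_upwards [hae] with x hx
    rcases (hz x).lt_or_eq with hpos | hzero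
    · exact (hx.1 hpos).le
    · exact (hx.2 hzero.symm).trans_le (min_le_right _ _)
  have hint : ∫ x in a..b, fo x ≤ ∫ _ in a..b, ν :=
    intervalIntegral.integral_mono_ae hab
      (intervalIntegrable_of_locallyIntegrable hfo _ _) intervalIntegrable_const hle
  rw [intervalIntegral.integral_const, smul_eq_mul, ← cumul_sub_cumul hfo] at hint
  linarith

lemma IsVickreyFlow.cumul_outflow_mono {τ ν : ℝ} {fi fo : ℝ → ℝ} (h : IsVickreyFlow τ ν fi fo)
    {a b : ℝ} (hab : a ≤ b) : cumul fo a ≤ cumul fo b := by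
  obtain ⟨-, hnn, -, -, hfo, -⟩ := h
  have := intervalIntegral.integral_nonneg (μ := volume) hab (fun x _ => hnn x)
  rw [← cumul_sub_cumul hfo] at this
  linarith

/-- The minimum in `F⁻(T + τ) = min_{s ∈ [0, T]} F⁺(s) + ν (T - s)` is attained at the last
time the queue was empty. -/
lemma IsVickreyFlow.exists_cumul_outflow_eq {τ ν : ℝ} (hτ : 0 < τ) {fi fo : ℝ → ℝ}
    (h : IsVickreyFlow τ ν fi fo) {T : ℝ} (hT : 0 ≤ T) :
    ∃ s ∈ Set.Icc 0 T, cumul fo (T + τ) = cumul fi s + ν * (T - s) := by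
  have hmono := h.cumul_outflow_mono hτ.le
  obtain ⟨-, -, -, hfi, hfo, -, -, hz, hae⟩ := h
  set S : Set ℝ := Set.Icc 0 T ∩ {s | cumul fi s - cumul fo (s + τ) = 0}
  have hcont : Continuous fun s => cumul fi s - cumul fo (s + τ) :=
    (continuous_cumul hfi).sub ((continuous_cumul hfo).comp (continuous_id.add continuous_const))
  have hcomp : IsCompact S := isCompact_Icc.inter_right (isClosed_eq hcont continuous_const)
  have hne : S.Nonempty := by
    refine ⟨0, ⟨le_rfl, hT⟩, ?_⟩
    have h0 := hz τ
    simp only [cumul, sub_self, intervalIntegral.integral_same, Set.mem_ofPred_eq, zero_add] at *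
    linarith
  obtain ⟨⟨hs0, hsT⟩, hs⟩ := hcomp.sSup_mem hne
  set s := sSup S
  refine ⟨s, ⟨hs0, hsT⟩, ?_⟩
  have hfull : ∀ᵐ x : ℝ, x ∈ Set.uIoc (s + τ) (T + τ) → fo x = ν := by
    filter_upwards [hae] with x hx hmem
    rw [Set.uIoc_of_le (by linarith)] at hmem
    refine hx.1 ((hz x).lt_of_ne fun heq => ?_)
    have : x - τ ∈ S := by
      refine ⟨⟨by linarith [hmem.1], by linarith [hmem.2]⟩, ?_⟩
      simpa using heq.symm
    linarith [le_csSup hcomp.bddAbove this, hmem.1]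
  have hint := intervalIntegral.integral_congr_ae hfull
  rw [intervalIntegral.integral_const, smul_eq_mul, ← cumul_sub_cumul hfo] at hint
  have hs' : cumul fi s - cumul fo (s + τ) = 0 := hs
  linarith

lemma IsVickreyFlow.cumul_outflow_le_add {τ ν C : ℝ} (hτ : 0 < τ) {fi fo gi go : ℝ → ℝ}
    (hf : IsVickreyFlow τ ν fi fo) (hg : IsVickreyFlow τ ν gi go) {T : ℝ} (hT : 0 ≤ T)
    (hC : ∀ s ∈ Set.Icc 0 T, cumul gi s ≤ cumul fi s + C) :
    cumul go (T + τ) ≤ cumul fo (T + τ) + C := by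
  obtain ⟨s, hs, heq⟩ := hf.exists_cumul_outflow_eq hτ hT
  have h1 := hg.cumul_outflow_le (show s + τ ≤ T + τ by linarith [hs.2])
  have h2 := hg.2.2.2.2.2.2.2.1 (s + τ)
  rw [add_sub_cancel_right] at h2
  rw [add_sub_add_right_eq_sub] at h1
  linarith [hC s hs]

lemma le_of_sInf_hitting_le {G : ℝ → ℝ} (hcont : ContinuousOn G (Set.Ici 0))
    (hmono : MonotoneOn G (Set.Ici 0)) {ψ t : ℝ} (hne : ∃ x, 0 ≤ x ∧ ψ ≤ G x)
    (ht : sInf {x : ℝ | 0 ≤ x ∧ ψ ≤ G x} ≤ t) : ψ ≤ G t := by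
  have hclosed : IsClosed {x : ℝ | 0 ≤ x ∧ ψ ≤ G x} :=
    hcont.preimage_isClosed_of_isClosed isClosed_Ici isClosed_Ici
  obtain ⟨h0, h1⟩ := hclosed.csInf_mem hne ⟨0, fun x hx => hx.1⟩
  exact h1.trans (hmono h0 (Set.mem_Ici.2 (h0.trans ht)) ht)

lemma le_add_of_hitting_close {F G : ℝ → ℝ} {β δ s : ℝ} {N : ℕ} (hβ : 0 < β) (hδ : 0 ≤ δ)
    (hs : 0 ≤ s) (hcont : ContinuousOn G (Set.Ici 0)) (hmono : MonotoneOn G (Set.Ici 0))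
    (hGnn : ∀ x, 0 ≤ x → 0 ≤ G x) (hGN : ∃ x, 0 ≤ x ∧ β * (N : ℝ) ≤ G x)
    (hF0 : 0 ≤ F s) (hFN : F s < β * ((N : ℝ) + 1))
    (hclose : ∀ q : ℕ, 1 ≤ q → q ≤ N → sInf {x : ℝ | 0 ≤ x ∧ β * (q : ℝ) ≤ F x} ≤ s →
      sInf {x : ℝ | 0 ≤ x ∧ β * (q : ℝ) ≤ G x} ≤ s + δ) :
    F s ≤ G (s + δ) + β := by
  set q := ⌊F s / β⌋₊
  have hq_le : β * (q : ℝ) ≤ F s := by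
    have := Nat.floor_le (div_nonneg hF0 hβ.le)
    rwa [le_div_iff₀' hβ] at this
  have hlt_q : F s < β * ((q : ℝ) + 1) := by
    have := Nat.lt_floor_add_one (F s / β)
    rwa [div_lt_iff₀' hβ] at this
  rcases Nat.eq_zero_or_pos q with hq | hq
  · rw [hq] at hlt_q
    have := hGnn (s + δ) (by linarith)
    norm_num at hlt_q
    linarith
  · have hqN : q ≤ N := by
      have := lt_of_mul_lt_mul_left (hq_le.trans_lt hFN) hβ.le
      exact Nat.lt_succ_iff.1 (by exact_mod_cast this)
    obtain ⟨x, hx0, hx⟩ := hGN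
    have hqN' : β * (q : ℝ) ≤ β * (N : ℝ) :=
      mul_le_mul_of_nonneg_left (by exact_mod_cast hqN) hβ.le
    have := le_of_sInf_hitting_le hcont hmono ⟨x, hx0, hqN'.trans hx⟩
      (hclose q hq hqN (csInf_le ⟨0, fun x hx => hx.1⟩ ⟨hs, hq_le⟩))
    linarith

lemma le_of_eventually_const {G : ℝ → ℝ} {c : ℝ} (hmono : MonotoneOn G (Set.Ici 0))
    (hev : ∃ Θ : ℝ, 0 ≤ Θ ∧ ∀ x : ℝ, Θ ≤ x → G x = c) {s : ℝ} (hs : 0 ≤ s) : G s ≤ c := by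
  obtain ⟨Θ, hΘ, h⟩ := hev
  rw [← h (max Θ s) (le_max_left _ _)]
  exact hmono hs (Set.mem_Ici.2 (hs.trans (le_max_right _ _))) (le_max_right _ _)

lemma sum_le_sum_add_of_lipschitz {J : Type*} [Fintype J] {F G : J → ℝ → ℝ}
    {κ α β δ s : ℝ} (hκ : 0 ≤ κ) (hδ : 0 ≤ δ) (hαδ : α ≤ δ)
    (hJβ : (Fintype.card J : ℝ) * β ≤ κ * α) (hs : 0 ≤ s)
    (hGlip : ∀ a b : ℝ, 0 ≤ a → 0 ≤ b → |(∑ j, G j a) - (∑ j, G j b)| ≤ κ * |a - b|)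
    (h : ∀ j, F j s ≤ G j (s + δ) + β) :
    ∑ j, F j s ≤ ∑ j, G j s + 2 * κ * δ := by
  have h1 : ∑ j, F j s ≤ ∑ j, G j (s + δ) + Fintype.card J * β := by
    refine (Finset.sum_le_sum fun j _ => h j).trans_eq ?_
    simp [Finset.sum_add_distrib]
  have h2 := (le_abs_self _).trans (hGlip (s + δ) s (by linarith) hs)
  rw [add_sub_cancel_left, abs_of_nonneg hδ] at h2
  have h3 := mul_le_mul_of_nonneg_left hαδ hκ
  linarith

/-- **Claim 2 in the proof of Lemma 5.3.** Under the hypotheses of the comparison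
setting (with the entrance-time closeness assumption up to `θ + 3δ` resp. `ζ + 3δ`),
the total cumulative outflows at the respective queue-entrance times of particle `φ`
are close: `|F⁻(θ + τ) − H⁻(ζ + τ)| ≤ 7κδ`. -/
theorem stmt_9_thm {J : Type} [Fintype J]
    (τ ν κ α β δ : ℝ) (hτ : 0 < τ) (hν : 0 < ν) (hκ : ν + 1 ≤ κ)
    (hα : 0 < α) (hβ : 0 < β) (hδ : 0 < δ) (hαδ : α ≤ δ)
    (hJβ : (Fintype.card J : ℝ) * β ≤ κ * α)
    (F H : J → ℝ → ℝ) (m : J → ℝ) (hm : ∀ j, 0 < m j)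
    (hFcont : ∀ j, ContinuousOn (F j) (Set.Ici 0))
    (hHcont : ∀ j, ContinuousOn (H j) (Set.Ici 0))
    (hFmono : ∀ j, MonotoneOn (F j) (Set.Ici 0))
    (hHmono : ∀ j, MonotoneOn (H j) (Set.Ici 0))
    (hF0 : ∀ j, F j 0 = 0) (hH0 : ∀ j, H j 0 = 0)
    (hFnn : ∀ j, ∀ x : ℝ, 0 ≤ x → 0 ≤ F j x)
    (hHnn : ∀ j, ∀ x : ℝ, 0 ≤ x → 0 ≤ H j x)
    (hFlip : ∀ a b : ℝ, 0 ≤ a → 0 ≤ b →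
      |(∑ j, F j a) - (∑ j, F j b)| ≤ κ * |a - b|)
    (hHlip : ∀ a b : ℝ, 0 ≤ a → 0 ≤ b →
      |(∑ j, H j a) - (∑ j, H j b)| ≤ κ * |a - b|)
    (hFev : ∀ j, ∃ Θ : ℝ, 0 ≤ Θ ∧ ∀ x : ℝ, Θ ≤ x → F j x = m j)
    (hHev : ∀ j, ∃ Θ : ℝ, 0 ≤ Θ ∧ ∀ x : ℝ, Θ ≤ x → H j x = β * (⌊m j / β⌋₊ : ℝ))
    (hHgrid : ∀ j, ∀ t : ℕ, ∃ k : ℕ, H j ((t : ℝ) * α) = β * (k : ℝ))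
    (fp fm hp hm' : ℝ → ℝ)
    (hVF : IsVickreyFlow τ ν fp fm) (hVH : IsVickreyFlow τ ν hp hm')
    (hFf : ∀ x : ℝ, 0 ≤ x → (∑ j, F j x) = cumul fp x)
    (hHh : ∀ x : ℝ, 0 ≤ x → (∑ j, H j x) = cumul hp x)
    (j₀ : J) (φ : ℝ) (p : ℕ) (hp1 : 1 ≤ p) (hφ : φ = β * (p : ℝ))
    (hφm : φ ≤ β * (⌊m j₀ / β⌋₊ : ℝ))
    (θ ζ : ℝ)
    (hθ : θ = sInf {x : ℝ | 0 ≤ x ∧ φ ≤ F j₀ x})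
    (hζ : ζ = sInf {x : ℝ | 0 ≤ x ∧ φ ≤ H j₀ x})
    (hclose : ∀ j' : J, ∀ ψ : ℝ, (∃ q : ℕ, 1 ≤ q ∧ ψ = β * (q : ℝ)) →
      ψ ≤ β * (⌊m j' / β⌋₊ : ℝ) →
      (sInf {x : ℝ | 0 ≤ x ∧ ψ ≤ F j' x} ≤ θ + 3 * δ ∨
        sInf {x : ℝ | 0 ≤ x ∧ ψ ≤ H j' x} ≤ ζ + 3 * δ) →
      |sInf {x : ℝ | 0 ≤ x ∧ ψ ≤ F j' x} - sInf {x : ℝ | 0 ≤ x ∧ ψ ≤ H j' x}| ≤ δ) :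
    |cumul fm (θ + τ) - cumul hm' (ζ + τ)| ≤ 7 * κ * δ := by
  have hκ0 : 0 ≤ κ := by linarith
  have hβm : ∀ j, β * (⌊m j / β⌋₊ : ℝ) ≤ m j := fun j => by
    have := Nat.floor_le (div_nonneg (hm j).le hβ.le)
    rwa [le_div_iff₀' hβ] at this
  have hmβ : ∀ j, m j < β * ((⌊m j / β⌋₊ : ℝ) + 1) := fun j => by
    have := Nat.lt_floor_add_one (m j / β)
    rwa [div_lt_iff₀' hβ] at this
  have hθζ : |θ - ζ| ≤ δ := by
    have := hclose j₀ φ ⟨p, hp1, hφ⟩ hφm (Or.inl (by rw [← hθ]; linarith))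
    rwa [← hθ, ← hζ] at this
  obtain ⟨hθζ₁, hθζ₂⟩ := abs_le.1 hθζ
  have hζ0 : 0 ≤ ζ := hζ ▸ Real.sInf_nonneg fun x hx => hx.1
  have hclose' : ∀ j, ∀ q : ℕ, 1 ≤ q → q ≤ ⌊m j / β⌋₊ →
      (sInf {x : ℝ | 0 ≤ x ∧ β * (q : ℝ) ≤ F j x} ≤ ζ ∨
        sInf {x : ℝ | 0 ≤ x ∧ β * (q : ℝ) ≤ H j x} ≤ ζ) →
      |sInf {x : ℝ | 0 ≤ x ∧ β * (q : ℝ) ≤ F j x} -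
        sInf {x : ℝ | 0 ≤ x ∧ β * (q : ℝ) ≤ H j x}| ≤ δ := fun j q hq hqN h =>
    hclose j _ ⟨q, hq, rfl⟩ (mul_le_mul_of_nonneg_left (by exact_mod_cast hqN) hβ.le)
      (h.imp (fun h => by linarith) (fun h => by linarith))
  have hFH : ∀ s ∈ Set.Icc 0 ζ, cumul fp s ≤ cumul hp s + 2 * κ * δ := by
    rintro s ⟨hs0, hsζ⟩
    rw [← hFf s hs0, ← hHh s hs0]
    refine sum_le_sum_add_of_lipschitz hκ0 hδ.le hαδ hJβ hs0 hHlip fun j => ?_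
    refine le_add_of_hitting_close (N := ⌊m j / β⌋₊) hβ hδ.le hs0 (hHcont j) (hHmono j) (hHnn j)
      ?_ (hFnn j s hs0) ((le_of_eventually_const (hFmono j) (hFev j) hs0).trans_lt (hmβ j))
      fun q hq hqN h => ?_
    · obtain ⟨Θ, hΘ, h⟩ := hHev j
      exact ⟨Θ, hΘ, (h Θ le_rfl).ge⟩
    · linarith [(abs_le.1 (hclose' j q hq hqN (Or.inl (h.trans hsζ)))).1]
  have hHF : ∀ s ∈ Set.Icc 0 ζ, cumul hp s ≤ cumul fp s + 2 * κ * δ := by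
    rintro s ⟨hs0, hsζ⟩
    rw [← hFf s hs0, ← hHh s hs0]
    refine sum_le_sum_add_of_lipschitz hκ0 hδ.le hαδ hJβ hs0 hFlip fun j => ?_
    refine le_add_of_hitting_close (N := ⌊m j / β⌋₊) hβ hδ.le hs0 (hFcont j) (hFmono j) (hFnn j)
      ?_ (hHnn j s hs0) ((le_of_eventually_const (hHmono j) (hHev j) hs0).trans_lt
        (by linarith)) fun q hq hqN h => ?_
    · obtain ⟨Θ, hΘ, h⟩ := hFev j
      exact ⟨Θ, hΘ, (hβm j).trans (h Θ le_rfl).ge⟩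
    · linarith [(abs_le.1 (hclose' j q hq hqN (Or.inr (h.trans hsζ)))).2]
  have hout₁ := hVF.cumul_outflow_le_add hτ hVH hζ0 hHF
  have hout₂ := hVH.cumul_outflow_le_add hτ hVF hζ0 hFH
  have hshift : |cumul fm (θ + τ) - cumul fm (ζ + τ)| ≤ κ * δ := by
    have hνκ : ν * |θ - ζ| ≤ κ * δ := mul_le_mul (by linarith) hθζ (abs_nonneg _) hκ0
    rcases le_total ζ θ with hle | hle
    · have h1 := hVF.cumul_outflow_mono (show ζ + τ ≤ θ + τ by linarith)
      have h2 := hVF.cumul_outflow_le (show ζ + τ ≤ θ + τ by linarith)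
      rw [add_sub_add_right_eq_sub] at h2
      rw [abs_of_nonneg (by linarith)] at hνκ
      rw [abs_le]
      constructor <;> linarith
    · have h1 := hVF.cumul_outflow_mono (show θ + τ ≤ ζ + τ by linarith)
      have h2 := hVF.cumul_outflow_le (show θ + τ ≤ ζ + τ by linarith)
      rw [add_sub_add_right_eq_sub] at h2
      rw [abs_of_nonpos (by linarith), neg_sub] at hνκ
      rw [abs_le]
      constructor <;> linarith
  obtain ⟨hshift₁, hshift₂⟩ := abs_le.1 hshift
  have hκδ : 0 ≤ κ * δ := mul_nonneg hκ0 hδ.le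
  rw [abs_le]
  constructor <;> linarith
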